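/- Fix real parameters M>0, l>0, a with |a|<l, and α<9/4. Then there exist ε₀ ∈ (0,1), H₀>0 and D>0, depending only on M, l, a, α, with the following property (Agmon estimate). Let h ∈ (0,H₀], κ > 0, and let u : [x_max, π/2) → ℝ be a nonzero twice continuously differentiable solution of −h²·u″ + V_h·u = κ·u on (x_max, π/2) with u(x_max)=0 and ∫_{x_max}^{π/2}(|u′|² + R²·u²) dx < ∞, and assume the set {x ∈ [x_max,π/2) : V_h(x) ≤ κ} is nonempty. Then for every ε ∈ (0, ε₀], writing φ = (1−ε)·d_κ, Ω⁺_ε = {x ∈ [x_max,π/2) : V_h(x) > κ+ε}, Ω⁻_ε = {x ∈ [x_max,π/2) : V_h(x) ≤ κ+ε}, and a(ε) = sup_{x ∈ Ω⁻_ε} d_κ(x), one has ∫_{x_max}^{π/2} h²·|(e^{φ(x)/h}·u(x))′|² dx + ε²·∫_{Ω⁺_ε} e^{2φ(x)/h}·u(x)² dx ≤ D·(κ+ε)·e^{2a(ε)/h}·∫_{x_max}^{π/2} u(x)² dx. -/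

import Mathlib

open Real MeasureTheory Set Filter Topology

/-- Δ₋(r) = (1+r²/l²)(r²+a²) − 2Mr -/
noncomputable def Dm (M l a r : ℝ) : ℝ := (1 + r^2/l^2)*(r^2+a^2) - 2*M*r

/-- V_σ(r) = Δ₋(r)/(r²+a²)² -/
noncomputable def Vsig (M l a r : ℝ) : ℝ := Dm M l a r / (r^2+a^2)^2

/-- Θ(α) = 1 if α>0, 0 if α≤0 -/
noncomputable def Th (α : ℝ) : ℝ := if 0 < α then 1 else 0

/-- V_junk -/
noncomputable def Vjunk (M l a α r : ℝ) : ℝ :=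
  -(3*r^2*(Dm M l a r)^2/(r^2+a^2)^4)
  + Dm M l a r * (5*r^4/l^2 + 3*r^2*(1+a^2/l^2) - 4*M*r + a^2)/(r^2+a^2)^3
  - (2/l^2) * (Dm M l a r * r^2/(r^2+a^2)^2)
  - (α/l^2) * (Dm M l a r /(r^2+a^2)^2) * Th α * a^2

/-- V_mass -/
noncomputable def Vmass (M l a α r : ℝ) : ℝ :=
  ((2-α)/l^2) * (Dm M l a r * r^2/(r^2+a^2)^2)

/-- The full potential in the tortoise coordinate, with semiclassical parameter h. -/
noncomputable def Vfull (M l a α : ℝ) (R : ℝ → ℝ) (h x : ℝ) : ℝ :=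
  Vsig M l a (R x) + h^2 * (Vjunk M l a α (R x) + Vmass M l a α (R x))

/-- κ is an eigenvalue of the Dirichlet problem P_DD(h). -/
def IsDirichletEigenvalue (M l a α : ℝ) (R : ℝ → ℝ) (xmax h κ : ℝ) : Prop :=
  ∃ u : ℝ → ℝ,
    (∃ x ∈ Set.Ico xmax (π/2), u x ≠ 0) ∧
    ContDiffOn ℝ 2 u (Set.Ico xmax (π/2)) ∧
    (∀ x ∈ Set.Ioo xmax (π/2),
      -h^2 * deriv (deriv u) x + Vfull M l a α R h x * u x = κ * u x) ∧
    u xmax = 0 ∧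
    MeasureTheory.IntegrableOn (fun x => (deriv u x)^2 + (R x)^2 * (u x)^2)
      (Set.Ioo xmax (π/2))


/-- The Agmon distance of x to the classical region {V_h ≤ κ} ⊆ [x_max, π/2). -/
noncomputable def agmonDist (M l a α : ℝ) (R : ℝ → ℝ) (xmax h κ x : ℝ) : ℝ :=
  sInf ((fun y => |∫ t in y..x, Real.sqrt (max 0 (Vfull M l a α R h t - κ))|) ''
    {y ∈ Set.Ico xmax (π/2) | Vfull M l a α R h y ≤ κ})

lemma Vjunk_eq (M l a α r : ℝ) (hl : 0 < l) (hr : 0 < r) :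
    Vjunk M l a α r = Vsig M l a r * ((r^2*a^2/l^2 - 4*M*r + a^2)/(r^2+a^2)
      + 6*M*r^3/(r^2+a^2)^2 - α * Th α * a^2/l^2) := by
  have hs : r^2 + a^2 ≠ 0 := by positivity
  unfold Vjunk Vsig Dm
  field_simp
  ring

lemma Vjunk_ge (M l a α r r1 : ℝ) (hM : 0 < M) (hl : 0 < l) (hr1 : 0 < r1) (hr : r1 ≤ r)
    (hD : 0 ≤ Dm M l a r) :
    -(4*M/r1 + |α| * a^2/l^2) * Vsig M l a r ≤ Vjunk M l a α r := by
  have hr0 : 0 < r := lt_of_lt_of_le hr1 hr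
  rw [Vjunk_eq M l a α r hl hr0]
  have hV : 0 ≤ Vsig M l a r := by unfold Vsig; positivity
  rw [mul_comm]
  apply mul_le_mul_of_nonneg_left _ hV
  have h1 : -(4*M/r1) ≤ (r^2*a^2/l^2 - 4*M*r + a^2)/(r^2+a^2) := by
    rw [le_div_iff₀ (by positivity), ← sub_nonneg]
    have e : r^2*a^2/l^2 - 4*M*r + a^2 - -(4*M/r1) * (r^2+a^2)
        = r^2*a^2/l^2 + a^2 + 4*M*a^2/r1 + 4*M*r*(r-r1)/r1 := by field_simp; ring
    rw [e]
    have : 0 ≤ r - r1 := by linarith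
    positivity
  have h2 : 0 ≤ 6*M*r^3/(r^2+a^2)^2 := by positivity
  have h3 : α * Th α * a^2/l^2 ≤ |α| * a^2/l^2 := by
    have : α * Th α ≤ |α| := by
      unfold Th; split_ifs
      · rw [mul_one]; exact le_abs_self α
      · rw [mul_zero]; exact abs_nonneg α
    gcongr
  linarith

lemma Vmass_ge (M l a α β r : ℝ) (hl : 0 < l) (hβ : α - 2 ≤ β) (hr : 0 < r)
    (hD : 0 ≤ Dm M l a r) :
    -(β * (Vsig M l a r * (r^2/l^2))) ≤ Vmass M l a α r := by
  have e : Vmass M l a α r = (2-α) * (Vsig M l a r * (r^2/l^2)) := by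
    unfold Vmass Vsig; field_simp
  have hV : 0 ≤ Vsig M l a r := by unfold Vsig; positivity
  rw [e, ← neg_mul]
  apply mul_le_mul_of_nonneg_right (by linarith) (by positivity)

lemma V_low (M l a α β r r1 r0 h : ℝ) (hM : 0 < M) (hl : 0 < l) (hr1 : 0 < r1) (hr : r1 ≤ r)
    (hβ : α - 2 ≤ β) (hβ0 : 0 ≤ β) (hβ1 : β ≤ 1)
    (hD : 0 ≤ Dm M l a r) (hrr : r ≤ r0)
    (hh : h^2 * (4*M/r1 + |α| * a^2/l^2 + r0^2/l^2) ≤ 1) :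
    0 ≤ Vsig M l a r + h^2 * (Vjunk M l a α r + Vmass M l a α r) := by
  have hr0 : 0 < r := lt_of_lt_of_le hr1 hr
  have hV : 0 ≤ Vsig M l a r := by unfold Vsig; positivity
  have h1 := Vjunk_ge M l a α r r1 hM hl hr1 hr hD
  have h2 := Vmass_ge M l a α β r hl hβ hr0 hD
  have h3 : r^2/l^2 ≤ r0^2/l^2 := by gcongr
  have h4 : β * (Vsig M l a r * (r^2/l^2)) ≤ 1 * (Vsig M l a r * (r0^2/l^2)) := by gcongr
  have h5 : h^2 * (-(4*M/r1 + |α| * a^2/l^2 + r0^2/l^2) * Vsig M l a r) ≤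
     h^2 * (Vjunk M l a α r + Vmass M l a α r) := by
    apply mul_le_mul_of_nonneg_left _ (sq_nonneg h); linarith
  have h6 := mul_le_mul_of_nonneg_right hh hV
  nlinarith

lemma q_bound (M l a r r0 : ℝ) (hM : 0 < M) (hl : 0 < l) (hr0 : 1 ≤ r0) (h4 : 4*M*l^2 ≤ r0)
    (hr : r0 ≤ r) :
    Vsig M l a r * (r^2/l^2) ≤
      4 * (Dm M l a r / (r^2+a^2) / (2*l^2) - ((r-r0)/(2*l^2))^2) := by
  have hrpos : 0 < r := by linarith
  have hs : 0 < r^2 + a^2 := by positivity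
  set t := 2*M*r/(r^2+a^2) with ht
  have htr : t * l^2 ≤ r0/2 := by
    have h1 : 2*M*r/(r^2+a^2) ≤ 2*M := by
      rw [div_le_iff₀ hs]
      nlinarith [mul_pos hM hrpos, sq_nonneg a, mul_nonneg hM.le (mul_nonneg hrpos.le (by linarith : 0 ≤ r - 1)), mul_nonneg hM.le (sq_nonneg a)]
    nlinarith [sq_nonneg l, mul_le_mul_of_nonneg_right h1 (sq_nonneg l)]
  have ht0 : 0 ≤ t := by positivity
  have e1 : Dm M l a r / (r^2+a^2) = 1 + r^2/l^2 - t := by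
    rw [ht]; unfold Dm; field_simp
  have e2 : Vsig M l a r * (r^2/l^2) = (Dm M l a r / (r^2+a^2)) * (r^2/(r^2+a^2)) / l^2 := by
    unfold Vsig; field_simp
  have hfrac : r^2/(r^2+a^2) ≤ 1 := by
    rw [div_le_one hs]; nlinarith [sq_nonneg a]
  have hfrac0 : 0 ≤ r^2/(r^2+a^2) := by positivity
  have h5 : Vsig M l a r * (r^2/l^2) ≤ (1 + r^2/l^2)/l^2 := by
    rw [e2, e1]
    have : (1 + r^2/l^2 - t) * (r^2/(r^2+a^2)) ≤ (1 + r^2/l^2) * 1 := by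
      apply mul_le_mul _ hfrac hfrac0 (by positivity); linarith
    rw [mul_one] at this
    gcongr
  refine h5.trans ?_
  rw [e1, ← sub_nonneg]
  have e3 : 4 * ((1 + r^2/l^2 - t)/(2*l^2) - ((r-r0)/(2*l^2))^2) - (1 + r^2/l^2)/l^2
    = (l^2 - 2*(t*l^2) + (2*r*r0 - r0^2))/l^4 := by field_simp; ring
  rw [e3]
  apply div_nonneg _ (by positivity)
  nlinarith [sq_nonneg l]

lemma V_high (M l a α β r r1 r0 h : ℝ) (hM : 0 < M) (hl : 0 < l) (hr1 : 0 < r1) (hr : r1 ≤ r)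
    (hβ : α - 2 ≤ β) (hβ0 : 0 ≤ β) (hr0 : 1 ≤ r0) (h4 : 4*M*l^2 ≤ r0)
    (hD : 0 ≤ Dm M l a r) (hrr : r0 ≤ r)
    (hh : h^2 * (4*M/r1 + |α| * a^2/l^2 + r0^2/l^2) ≤ 1) :
    0 ≤ Dm M l a r / (r^2+a^2) / (2*l^2) - ((r-r0)/(2*l^2))^2 ∧
    -(4*β*h^2*(Dm M l a r / (r^2+a^2) / (2*l^2) - ((r-r0)/(2*l^2))^2)) ≤
      Vsig M l a r + h^2 * (Vjunk M l a α r + Vmass M l a α r) := by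
  have hr0 : 0 < r := lt_of_lt_of_le hr1 hr
  have hV : 0 ≤ Vsig M l a r := by unfold Vsig; positivity
  have hq := q_bound M l a r r0 hM hl (by assumption) h4 hrr
  set q := Dm M l a r / (r^2+a^2) / (2*l^2) - ((r-r0)/(2*l^2))^2
  have hp : 0 ≤ Vsig M l a r * (r^2/l^2) := by positivity
  refine ⟨by linarith, ?_⟩
  have h1 := Vjunk_ge M l a α r r1 hM hl hr1 hr hD
  have h2 := Vmass_ge M l a α β r hl hβ hr0 hD
  have h3 := mul_le_mul_of_nonneg_left h1 (sq_nonneg h)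
  have h5 := mul_le_mul_of_nonneg_left h2 (sq_nonneg h)
  have h6 := mul_le_mul_of_nonneg_left hq (mul_nonneg hβ0 (sq_nonneg h))
  have h7 : h^2 * (4*M/r1 + |α| * a^2/l^2) ≤ 1 := by
    refine le_trans ?_ hh
    apply mul_le_mul_of_nonneg_left _ (sq_nonneg h)
    have : 0 ≤ r0^2/l^2 := by positivity
    linarith
  have h8 := mul_le_mul_of_nonneg_right h7 hV
  linarith

lemma abs_deriv_le {f G : ℝ → ℝ} {f' g' x : ℝ} (hf : HasDerivAt f f' x) (hG : HasDerivAt G g' x)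
    (h : ∀ᶠ y in 𝓝 x, |f y - f x| ≤ |G y - G x|) : |f'| ≤ |g'| := by
  rw [hasDerivAt_iff_tendsto_slope] at hf hG
  refine le_of_tendsto_of_tendsto hf.abs hG.abs ?_
  filter_upwards [h.filter_mono nhdsWithin_le_nhds] with y hy
  rw [slope_def_field, slope_def_field, abs_div, abs_div]
  gcongr

lemma core {A b h κ ε B : ℝ} (hAb : A ≤ b) (hh : 0 < h) (hB0 : 0 ≤ B) (hB1 : B < 1)
    {u v V ψ G : ℝ → ℝ} {Ω : Set ℝ} (hΩ : MeasurableSet Ω)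
    (hu : ∀ x ∈ Ioo A b, HasDerivAt u (v x) x)
    (hv : ∀ x ∈ Ioo A b, HasDerivAt v ((V x - κ) * u x / h^2) x)
    (uac : AbsolutelyContinuousOnInterval u A b)
    (vac : AbsolutelyContinuousOnInterval v A b)
    (ψac : AbsolutelyContinuousOnInterval ψ A b)
    (eac : AbsolutelyContinuousOnInterval (fun t => exp (ψ t)) A b)
    (Gac : AbsolutelyContinuousOnInterval G A b)
    (hu0 : u A = 0)
    (hpt : ∀ x ∈ Ioo A b, ∀ ψ' g', HasDerivAt ψ ψ' x → HasDerivAt G g' x →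
      ε^2 * Ω.indicator (fun t => (exp (ψ t) * u t)^2) x - κ * (u x)^2
        - B * h^2 * (g' - (G x)^2) * (exp (ψ x) * u x)^2
      ≤ (V x - κ - h^2 * ψ'^2) * (exp (ψ x) * u x)^2) (hκ : 0 < κ) :
    IntervalIntegrable (fun x => h^2 * (deriv (fun t => exp (ψ t) * u t) x)^2
          + ε^2 * Ω.indicator (fun t => (exp (ψ t) * u t)^2) x) volume A b ∧
    (1-B) * (∫ x in A..b, (h^2 * (deriv (fun t => exp (ψ t) * u t) x)^2
          + ε^2 * Ω.indicator (fun t => (exp (ψ t) * u t)^2) x)) - κ * (∫ x in A..b, (u x)^2) ≤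
      h^2 * ((exp (ψ b))^2 * (u b * v b)) + B * h^2 * (G b * (exp (ψ b) * u b)^2) := by
  set w : ℝ → ℝ := fun t => exp (ψ t) * u t with hw
  have wac : AbsolutelyContinuousOnInterval w A b := eac.fun_mul uac
  set P : ℝ → ℝ := fun x => h^2 * (deriv w x)^2
          + ε^2 * Ω.indicator (fun t => (w t)^2) x with hP
  set E : ℝ → ℝ := fun x => h^2 * ((exp (ψ x) * exp (ψ x)) * (u x * v x))
    + B * h^2 * (G x * (w x * w x)) with hE
  have Eac : AbsolutelyContinuousOnInterval E A b := by
    apply AbsolutelyContinuousOnInterval.fun_add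
    · exact AbsolutelyContinuousOnInterval.const_mul _ ((eac.fun_mul eac).fun_mul (uac.fun_mul vac))
    · exact AbsolutelyContinuousOnInterval.const_mul _ (Gac.fun_mul (wac.fun_mul wac))
  have Eint := Eac.intervalIntegrable_deriv
  have EFTC := Eac.integral_deriv_eq_sub
  have hP0 : ∀ x, 0 ≤ P x := by
    intro x
    have : 0 ≤ Ω.indicator (fun t => (w t)^2) x := indicator_nonneg (fun t _ => sq_nonneg _) x
    positivity
  have key : ∀ᵐ x, x ∈ Ioc A b → (1-B) * P x - κ * (u x)^2 ≤ deriv E x := by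
    have hb : ∀ᵐ x : ℝ, x ≠ b := by
      simp [ae_iff, measure_singleton]
    filter_upwards [ψac.ae_differentiableAt, Gac.ae_differentiableAt, hb] with x h1 h2 h3 hx
    have hxI : x ∈ uIcc A b := by rw [uIcc_of_le hAb]; exact Ioc_subset_Icc_self hx
    have hxo : x ∈ Ioo A b := ⟨hx.1, lt_of_le_of_ne hx.2 h3⟩
    have hψ := (h1 hxI).hasDerivAt
    have hG := (h2 hxI).hasDerivAt
    have hux := hu x hxo
    have hvx := hv x hxo
    have hpx := hpt x hxo _ _ hψ hG
    generalize deriv ψ x = ψ' at *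
    generalize deriv G x = g' at *
    have hp := hψ.exp
    have hwx : HasDerivAt w (exp (ψ x) * ψ' * u x + exp (ψ x) * v x) x := hp.mul hux
    have hEx := (((hp.mul hp).mul (hux.mul hvx)).const_mul (h^2)).add
      ((hG.mul (hwx.mul hwx)).const_mul (B*h^2))
    have hEx' : deriv E x = _ := hEx.deriv
    rw [hEx', hP]
    simp only [hwx.deriv, Pi.mul_apply]
    have hind : 0 ≤ Ω.indicator (fun t => (w t)^2) x := indicator_nonneg (fun t _ => sq_nonneg _) x
    have hwdef : w x = exp (ψ x) * u x := rfl
    have hind' : 0 ≤ B * (ε^2 * Ω.indicator (fun t => (w t)^2) x) := by positivity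
    have hsq : 0 ≤ B * h^2 * (exp (ψ x) * ψ' * u x + exp (ψ x) * v x + G x * w x)^2 := by positivity
    change ε^2 * Ω.indicator (fun t => (w t)^2) x - κ * (u x)^2
        - B * h^2 * (g' - (G x)^2) * (exp (ψ x) * u x)^2
      ≤ (V x - κ - h^2 * ψ'^2) * (exp (ψ x) * u x)^2 at hpx
    generalize Ω.indicator (fun t => (w t)^2) x = I at *
    rw [hwdef] at *
    have e : h^2 * (v x * ((V x - κ) * u x / h^2)) = v x * ((V x - κ) * u x) := by field_simp
    have e' : h^2 * (u x * ((V x - κ) * u x / h^2)) = u x * ((V x - κ) * u x) := by field_simp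
    generalize (V x - κ) * u x / h^2 = Z at *
    have e'' : h^2 * (exp (ψ x) * exp (ψ x) * (u x * Z)) = exp (ψ x) * exp (ψ x) * (u x * ((V x - κ) * u x)) := by
      rw [← e']; ring
    nlinarith [hpx, hsq, hind', e'']
  have ucont : ContinuousOn u (uIcc A b) := uac.continuousOn
  have wcont : ContinuousOn w (uIcc A b) := wac.continuousOn
  have u2int : IntervalIntegrable (fun x => (u x)^2) volume A b := (ucont.pow 2).intervalIntegrable
  have Pint : IntervalIntegrable P volume A b := by
    have hdom : IntervalIntegrable (fun x => (1-B)⁻¹ * (deriv E x + κ * (u x)^2)) volume A b :=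
      (Eint.add (u2int.const_mul κ)).const_mul _
    have hmeas : AEStronglyMeasurable P (volume.restrict (Ioc A b)) := by
      apply AEStronglyMeasurable.add
      · exact (((measurable_deriv w).pow_const 2).const_mul _).aestronglyMeasurable
      · apply AEStronglyMeasurable.const_mul
        apply AEStronglyMeasurable.indicator _ hΩ
        have : ContinuousOn (fun t => (w t)^2) (Ioc A b) :=
          (wcont.pow 2).mono (by rw [uIcc_of_le hAb]; exact Ioc_subset_Icc_self)
        exact this.aestronglyMeasurable measurableSet_Ioc
    rw [intervalIntegrable_iff_integrableOn_Ioc_of_le hAb] at hdom ⊢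
    refine Integrable.mono' hdom hmeas ?_
    rw [ae_restrict_iff' measurableSet_Ioc]
    filter_upwards [key] with x hx hxI
    have := hx hxI
    rw [Real.norm_of_nonneg (hP0 x), inv_mul_eq_div, le_div_iff₀ (by linarith)]
    linarith
  refine ⟨Pint, ?_⟩
  have hle : ∫ x in A..b, ((1-B) * P x - κ * (u x)^2) ≤ ∫ x in A..b, deriv E x := by
    apply intervalIntegral.integral_mono_ae_restrict hAb _ Eint
    · rw [EventuallyLE, ae_restrict_iff' measurableSet_Icc]
      have hA : ∀ᵐ x : ℝ, x ≠ A := by simp [ae_iff, measure_singleton]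
      filter_upwards [key, hA] with x hx hxA hxI
      exact hx ⟨lt_of_le_of_ne hxI.1 (Ne.symm hxA), hxI.2⟩
    · exact (Pint.const_mul _).sub (u2int.const_mul _)
  rw [intervalIntegral.integral_sub (Pint.const_mul _) (u2int.const_mul _),
    intervalIntegral.integral_const_mul, intervalIntegral.integral_const_mul, EFTC] at hle
  have hEA : E A = 0 := by simp [hE, hw, hu0]
  rw [hEA] at hle
  refine hle.trans (le_of_eq ?_)
  simp only [hE, hw]; ring

lemma agm_lip {W : ℝ → ℝ} {S : Set ℝ} {c : ℝ} (hW : ContinuousOn W (Iio c)) (hS : S ⊆ Iio c)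
    (hne : S.Nonempty) {x y : ℝ} (hx : x < c) (hy : y < c) :
    |sInf ((fun z => |∫ t in z..x, W t|) '' S) - sInf ((fun z => |∫ t in z..y, W t|) '' S)|
      ≤ |∫ t in y..x, W t| := by
  have hint : ∀ {p q : ℝ}, p < c → q < c → IntervalIntegrable W volume p q := by
    intro p q hp hq
    apply ContinuousOn.intervalIntegrable
    apply hW.mono
    intro t ht
    exact lt_of_le_of_lt ht.2 (max_lt hp hq)
  have main : ∀ {x y : ℝ}, x < c → y < c →
      sInf ((fun z => |∫ t in z..x, W t|) '' S) ≤
        sInf ((fun z => |∫ t in z..y, W t|) '' S) + |∫ t in y..x, W t| := by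
    intro x y hx hy
    rw [← sub_le_iff_le_add]
    apply le_csInf (hne.image _)
    rintro _ ⟨z, hz, rfl⟩
    rw [sub_le_iff_le_add]
    have hbdd : BddBelow ((fun z => |∫ t in z..x, W t|) '' S) :=
      ⟨0, by rintro _ ⟨z, _, rfl⟩; exact abs_nonneg _⟩
    refine (csInf_le hbdd ⟨z, hz, rfl⟩).trans ?_
    have := intervalIntegral.integral_add_adjacent_intervals
      (hint (hS hz) hy) (hint hy hx)
    simp only
    rw [← this]
    exact abs_add_le _ _
  have h1 := main hx hy
  have h2 := main hy hx
  rw [intervalIntegral.integral_symm, abs_neg] at h2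
  rw [abs_sub_le_iff]
  constructor <;> linarith

lemma main_abs {A c h κ ε B : ℝ} (hAc : A < c) (hh : 0 < h) (hB0 : 0 ≤ B) (hB1 : B < 1)
    (hκ : 0 < κ) (hε0 : 0 < ε) (hε1 : ε < 1)
    {u V G d : ℝ → ℝ} (hV : ContinuousOn V (Iio c))
    (hu2 : ContDiffOn ℝ 2 u (Ico A c))
    (hode : ∀ x ∈ Ioo A c, -h^2 * deriv (deriv u) x + V x * u x = κ * u x)
    (hu0 : u A = 0)
    (Gac : ∀ b, A < b → b < c → AbsolutelyContinuousOnInterval G A b)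
    (hG0 : ∀ x, 0 ≤ G x)
    (hq : ∀ x ∈ Ioo A c, ∀ g', HasDerivAt G g' x →
      0 ≤ g' - (G x)^2 ∧ -(B * h^2 * (g' - (G x)^2)) ≤ V x)
    (hd0 : ∀ x, 0 ≤ d x) (hdS : ∀ x ∈ Ico A c, V x ≤ κ → d x = 0)
    (hd : ∀ x < c, ∀ y < c, |d x - d y| ≤ |∫ t in y..x, √(max 0 (V t - κ))|)
    (huint : IntegrableOn (fun x => (u x)^2) (Ioo A c))
    (hbd : ∀ K > 0, ∀ η > 0, ∃ᶠ b in 𝓝[<] c, K * (|u b * deriv u b| + G b * (u b)^2) < η) :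
    (1 - B) * ((∫ x in Ioo A c, h^2 * (deriv (fun t => exp ((1-ε) * d t / h) * u t) x)^2)
      + ε^2 * (∫ x in {x ∈ Ico A c | V x > κ + ε}, exp (2 * (1-ε) * d x / h) * (u x)^2))
      ≤ κ * ∫ x in Ioo A c, (u x)^2 := by
  set W : ℝ → ℝ := fun t => √(max 0 (V t - κ)) with hWdef
  have hWc : ContinuousOn W (Iio c) := by
    apply ContinuousOn.sqrt
    exact continuousOn_const.sup (hV.sub continuousOn_const)
  have hW0 : ∀ x, 0 ≤ W x := fun x => sqrt_nonneg _
  -- local bound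
  have hWb : ∀ b < c, ∃ K : NNReal, ∀ x ∈ Icc A b, ∀ y ∈ Icc A b, |∫ t in y..x, W t| ≤ K * |x - y| := by
    intro b hb
    obtain ⟨K, hK⟩ := isCompact_Icc.exists_bound_of_continuousOn
      (hWc.mono (fun t (ht : t ∈ Icc A b) => lt_of_le_of_lt ht.2 hb))
    refine ⟨K.toNNReal, fun x hx y hy => ?_⟩
    rw [← Real.norm_eq_abs]
    apply intervalIntegral.norm_integral_le_of_norm_le_const
    intro t ht
    refine (hK t ?_).trans (Real.le_coe_toNNReal K)
    have ht' := uIoc_subset_uIcc ht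
    exact uIcc_subset_Icc hy hx ht'
  have hdlip : ∀ b < c, ∃ K : NNReal, LipschitzOnWith K d (Icc A b) := by
    intro b hb
    obtain ⟨K, hK⟩ := hWb b hb
    refine ⟨K, LipschitzOnWith.of_dist_le_mul fun x hx y hy => ?_⟩
    rw [Real.dist_eq, Real.dist_eq]
    exact (hd x (lt_of_le_of_lt hx.2 hb) y (lt_of_le_of_lt hy.2 hb)).trans (hK x hx y hy)
  have hWint : ∀ {p q : ℝ}, p < c → q < c → IntervalIntegrable W volume p q := by
    intro p q hp hq
    apply ContinuousOn.intervalIntegrable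
    apply hWc.mono
    intro t ht
    exact lt_of_le_of_lt ht.2 (max_lt hp hq)
  have hWder : ∀ x < c, HasDerivAt (fun y => ∫ t in x..y, W t) (W x) x := by
    intro x hx
    apply intervalIntegral.integral_hasDerivAt_right (hWint hx hx)
    · exact hWc.stronglyMeasurableAtFilter isOpen_Iio x hx
    · exact hWc.continuousAt (Iio_mem_nhds hx)
  have hdcont : ContinuousOn d (Ico A c) := by
    intro x hx
    have hxm : (x + c)/2 < c := by linarith [hx.2]
    obtain ⟨K, hK⟩ := hdlip ((x+c)/2) hxm
    have := hK.continuousOn x ⟨hx.1, by linarith [hx.2]⟩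
    apply this.mono_of_mem_nhdsWithin
    filter_upwards [self_mem_nhdsWithin, nhdsWithin_le_nhds (Iio_mem_nhds (show x < (x+c)/2 by linarith [hx.2]))] with y hy1 hy2
    exact ⟨hy1.1, le_of_lt hy2⟩
  have hdcontAt : ∀ x ∈ Ioo A c, ContinuousAt d x := fun x hx =>
    hdcont.continuousAt (Ico_mem_nhds hx.1 hx.2)
  set Ω : Set ℝ := {x ∈ Ico A c | V x > κ + ε} with hΩdef
  have hΩm : MeasurableSet Ω := by
    have h1 : IsOpen (Iio c ∩ V ⁻¹' (Ioi (κ + ε))) := hV.isOpen_inter_preimage isOpen_Iio isOpen_Ioi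
    have : Ω = Ico A c ∩ (Iio c ∩ V ⁻¹' (Ioi (κ + ε))) := by
      ext x; simp only [hΩdef, mem_ofPred_eq, mem_inter_iff, mem_Ico, mem_Iio, mem_preimage, mem_Ioi]
      tauto
    rw [this]
    exact measurableSet_Ico.inter h1.measurableSet
  set v : ℝ → ℝ := derivWithin u (Ico A c) with hvdef
  have hv1 : ContDiffOn ℝ 1 v (Ico A c) :=
    hu2.derivWithin (uniqueDiffOn_Ico A c) (by norm_num)
  have hvu : ∀ x ∈ Ioo A c, v x = deriv u x := fun x hx =>
    derivWithin_of_mem_nhds (Ico_mem_nhds hx.1 hx.2)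
  have hud : ∀ x ∈ Ioo A c, HasDerivAt u (v x) x := by
    intro x hx
    rw [hvu x hx]
    exact ((hu2.differentiableOn (by norm_num)).differentiableAt (Ico_mem_nhds hx.1 hx.2)).hasDerivAt
  have hvd : ∀ x ∈ Ioo A c, HasDerivAt v ((V x - κ) * u x / h^2) x := by
    intro x hx
    have h1 := ((hv1.differentiableOn (by norm_num)).differentiableAt (Ico_mem_nhds hx.1 hx.2)).hasDerivAt
    have h2 : deriv v x = deriv (deriv u) x := by
      apply Filter.EventuallyEq.deriv_eq
      filter_upwards [Ioo_mem_nhds hx.1 hx.2] with y hy using hvu y hy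
    have h3 : deriv v x = (V x - κ) * u x / h^2 := by
      rw [h2, eq_div_iff (by positivity)]
      linarith [hode x hx]
    rwa [h3] at h1
  set w : ℝ → ℝ := fun t => exp ((1-ε) * d t / h) * u t with hw
  set P : ℝ → ℝ := fun x => h^2 * (deriv w x)^2 + ε^2 * Ω.indicator (fun t => (w t)^2) x with hP
  have hP0 : ∀ x, 0 ≤ P x := by
    intro x
    have : 0 ≤ Ω.indicator (fun t => (w t)^2) x := indicator_nonneg (fun t _ => sq_nonneg _) x
    positivity
  have step : ∀ b1, A < b1 → b1 < c → IntervalIntegrable P volume A b1 ∧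
      (1-B) * (∫ x in A..b1, P x) ≤ κ * ∫ x in Ioo A c, (u x)^2 := by
    intro b1 hAb1 hb1
    obtain ⟨N0, hN0⟩ := isCompact_Icc.exists_bound_of_continuousOn
      (hdcont.mono (fun t (ht : t ∈ Icc A b1) => (⟨ht.1, lt_of_le_of_lt ht.2 hb1⟩ : t ∈ Ico A c)))
    set N : ℝ := |N0| + 1 with hN
    have hNpos : 0 < N := by positivity
    have hdN : ∀ x ∈ Icc A b1, d x < N := by
      intro x hx
      have := hN0 x hx
      rw [Real.norm_eq_abs, abs_of_nonneg (hd0 x)] at this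
      linarith [le_abs_self N0]
    set ψ : ℝ → ℝ := fun x => (1-ε) * min (d x) N / h with hψ
    have hψ0 : ∀ x, 0 ≤ ψ x := by
      intro x
      have : 0 ≤ min (d x) N := le_min (hd0 x) hNpos.le
      have : 0 ≤ 1 - ε := by linarith
      positivity
    have hψN : ∀ x, ψ x ≤ N / h := by
      intro x
      have h1 : min (d x) N ≤ N := min_le_right _ _
      have h2 : 0 ≤ min (d x) N := le_min (hd0 x) hNpos.le
      simp only [hψ]
      gcongr
      nlinarith
    have hψd : ∀ x < c, ∀ y < c, |ψ x - ψ y| ≤ (1-ε)/h * |∫ t in y..x, W t| := by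
      intro x hx y hy
      have e : ψ x - ψ y = (1-ε)/h * (min (d x) N - min (d y) N) := by simp only [hψ]; ring
      have h0 : 0 ≤ (1-ε)/h := div_nonneg (by linarith) hh.le
      rw [e, abs_mul, abs_of_nonneg h0]
      apply mul_le_mul_of_nonneg_left _ h0
      have := abs_min_sub_min_le_max (d x) N (d y) N
      rw [sub_self, abs_zero, max_eq_left (abs_nonneg _)] at this
      exact this.trans (hd x hx y hy)
    have hψlip : ∀ b < c, ∃ K : NNReal, LipschitzOnWith K ψ (Icc A b) := by
      intro b hb
      obtain ⟨K, hK⟩ := hWb b hb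
      have h0 : 0 ≤ (1-ε)/h := div_nonneg (by linarith) hh.le
      refine ⟨((1-ε)/h).toNNReal * K, LipschitzOnWith.of_dist_le_mul fun x hx y hy => ?_⟩
      rw [Real.dist_eq, Real.dist_eq, NNReal.coe_mul, Real.coe_toNNReal _ h0, mul_assoc]
      exact (hψd x (lt_of_le_of_lt hx.2 hb) y (lt_of_le_of_lt hy.2 hb)).trans
        (mul_le_mul_of_nonneg_left (hK x hx y hy) h0)
    have hpt : ∀ x ∈ Ioo A c, ∀ ψ' g', HasDerivAt ψ ψ' x → HasDerivAt G g' x →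
      ε^2 * Ω.indicator (fun t => (exp (ψ t) * u t)^2) x - κ * (u x)^2
        - B * h^2 * (g' - (G x)^2) * (exp (ψ x) * u x)^2
      ≤ (V x - κ - h^2 * ψ'^2) * (exp (ψ x) * u x)^2 := by
      intro x hx ψ' g' hψ' hg'
      obtain ⟨hq1, hq2⟩ := hq x hx g' hg'
      have hbound : |ψ'| ≤ |(1-ε)/h * W x| := by
        apply abs_deriv_le hψ' ((hWder x hx.2).const_mul ((1-ε)/h))
        filter_upwards [Iio_mem_nhds hx.2] with y hy
        have h0 : 0 ≤ (1-ε)/h := div_nonneg (by linarith) hh.le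
        rw [intervalIntegral.integral_same, mul_zero, sub_zero, abs_mul, abs_of_nonneg h0]
        exact hψd y hy x hx.2
      have hsq : h^2 * ψ'^2 ≤ (1-ε)^2 * (W x)^2 := by
        have h1 : ψ'^2 ≤ ((1-ε)/h * W x)^2 := sq_le_sq.mpr hbound
        calc h^2 * ψ'^2 ≤ h^2 * ((1-ε)/h * W x)^2 := by gcongr
          _ = (1-ε)^2 * (W x)^2 := by field_simp
      have hW2 : (W x)^2 = max 0 (V x - κ) := by
        rw [hWdef]; exact sq_sqrt (le_max_left _ _)
      rw [hW2] at hsq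
      have hBq : 0 ≤ B * h^2 * (g' - (G x)^2) := by positivity
      rcases le_or_gt (V x) κ with hVk | hVk
      · have hnot : x ∉ Ω := fun hx' => by have := hx'.2; linarith
        rw [indicator_of_notMem hnot]
        have hd00 := hdS x ⟨hx.1.le, hx.2⟩ hVk
        have hψz : ψ x = 0 := by simp [hψ, hd00, hNpos.le]
        rw [max_eq_left (by linarith), mul_zero] at hsq
        rw [hψz, exp_zero, one_mul]
        nlinarith [sq_nonneg (u x)]
      · rw [max_eq_right (by linarith)] at hsq
        set X := (exp (ψ x) * u x)^2 with hX
        have hX0 : 0 ≤ X := sq_nonneg _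
        have h1 : ε * (V x - κ) ≤ V x - κ - h^2 * ψ'^2 := by
          nlinarith [mul_pos hε0 (sub_pos.mpr hVk)]
        have h2 : ε^2 * Ω.indicator (fun t => (exp (ψ t) * u t)^2) x ≤ ε * (V x - κ) * X := by
          by_cases hxΩ : x ∈ Ω
          · rw [indicator_of_mem hxΩ]
            have : κ + ε < V x := hxΩ.2
            apply mul_le_mul_of_nonneg_right _ hX0
            nlinarith
          · rw [indicator_of_notMem hxΩ, mul_zero]
            have : 0 ≤ V x - κ := by linarith
            positivity
        have h3 := mul_le_mul_of_nonneg_right h1 hX0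
        have h4 := mul_nonneg hBq hX0
        have h5 : 0 ≤ κ * (u x)^2 := by positivity
        linarith
    set PN : ℝ → ℝ := fun x => h^2 * (deriv (fun t => exp (ψ t) * u t) x)^2
          + ε^2 * Ω.indicator (fun t => (exp (ψ t) * u t)^2) x with hPN
    have hPN0 : ∀ x, 0 ≤ PN x := by
      intro x
      have : 0 ≤ Ω.indicator (fun t => (exp (ψ t) * u t)^2) x :=
        indicator_nonneg (fun t _ => sq_nonneg _) x
      positivity
    have hEq : ∀ x ∈ Ioc A b1, PN x = P x := by
      intro x hx
      have hxN : d x < N := hdN x ⟨hx.1.le, hx.2⟩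
      have hev : ∀ᶠ y in 𝓝 x, d y < N :=
        (hdcontAt x ⟨hx.1, lt_of_le_of_lt hx.2 hb1⟩).eventually (gt_mem_nhds hxN)
      have hev' : (fun t => exp (ψ t) * u t) =ᶠ[𝓝 x] w := by
        filter_upwards [hev] with y hy
        simp only [hψ, hw, min_eq_left hy.le]
      simp only [hPN, hP]
      rw [hev'.deriv_eq]
      congr 2
      by_cases hxΩ : x ∈ Ω
      · rw [indicator_of_mem hxΩ, indicator_of_mem hxΩ]
        have h9 : exp (ψ x) * u x = w x := hev'.eq_of_nhds
        rw [h9]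
      · rw [indicator_of_notMem hxΩ, indicator_of_notMem hxΩ]
    have hb : ∀ η > 0, IntervalIntegrable P volume A b1 ∧
      (1-B) * (∫ x in A..b1, P x) ≤ κ * (∫ x in Ioo A c, (u x)^2) + η := by
      intro η hη
      have hfr := hbd (h^2 * (exp (N/h))^2) (by positivity) η hη
      obtain ⟨b, hbE, hbm⟩ := (hfr.and_eventually
        (Ioo_mem_nhdsLT hb1)).exists
      have hAb : A < b := hAb1.trans hbm.1
      have hbA : b ∈ Ioo A c := ⟨hAb, hbm.2⟩
      have hsub : uIcc A b ⊆ Ico A c := by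
        rw [uIcc_of_le hAb.le]; exact fun t ht => ⟨ht.1, lt_of_le_of_lt ht.2 hbm.2⟩
      obtain ⟨K, hK⟩ := hψlip b hbm.2
      have hψac : AbsolutelyContinuousOnInterval ψ A b := by
        apply LipschitzOnWith.absolutelyContinuousOnInterval (K := K)
        rwa [uIcc_of_le hAb.le]
      have heac : AbsolutelyContinuousOnInterval (fun t => exp (ψ t)) A b := by
        obtain ⟨K', hK'⟩ := (Real.contDiff_exp (n := 1)).contDiffOn.exists_lipschitzOnWith
          (by norm_num) (convex_Icc 0 (N/h)) isCompact_Icc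
        apply LipschitzOnWith.absolutelyContinuousOnInterval (K := K' * K)
        rw [uIcc_of_le hAb.le]
        exact hK'.comp hK (fun x _ => ⟨hψ0 x, hψN x⟩)
      obtain ⟨c1, c2⟩ := core hAb.le hh hB0 hB1 hΩm
        (fun x hx => hud x ⟨hx.1, hx.2.trans hbm.2⟩)
        (fun x hx => hvd x ⟨hx.1, hx.2.trans hbm.2⟩)
        ((hu2.mono hsub).of_le (by norm_num)).absolutelyContinuousOnInterval
        (hv1.mono hsub).absolutelyContinuousOnInterval
        hψac heac (Gac b hAb hbm.2) hu0
        (fun x hx => hpt x ⟨hx.1, hx.2.trans hbm.2⟩) hκ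
      change IntervalIntegrable PN volume A b at c1
      change (1-B) * (∫ x in A..b, PN x) - _ ≤ _ at c2
      have hPN1 : IntervalIntegrable PN volume A b1 := by
        apply c1.mono_set
        rw [uIcc_of_le hAb.le, uIcc_of_le hAb1.le]
        exact Icc_subset_Icc_right hbm.1.le
      have hcong : ∫ x in A..b1, PN x = ∫ x in A..b1, P x := by
        apply intervalIntegral.integral_congr_ae
        refine Filter.Eventually.of_forall fun x hx => ?_
        rw [uIoc_of_le hAb1.le] at hx
        exact hEq x hx
      have hmono : ∫ x in A..b1, PN x ≤ ∫ x in A..b, PN x := by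
        apply intervalIntegral.integral_mono_interval le_rfl hAb1.le hbm.1.le _ c1
        exact Filter.Eventually.of_forall fun x => hPN0 x
      have hu2le : ∫ x in A..b, (u x)^2 ≤ ∫ x in Ioo A c, (u x)^2 := by
        rw [intervalIntegral.integral_of_le hAb.le]
        apply setIntegral_mono_set huint
        · exact Filter.Eventually.of_forall fun x => sq_nonneg _
        · exact LE.le.eventuallyLE (fun t ht => ⟨ht.1, lt_of_le_of_lt ht.2 hbm.2⟩)
      have hEb : h^2 * ((exp (ψ b))^2 * (u b * v b)) + B * h^2 * (G b * (exp (ψ b) * u b)^2) ≤ η := by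
        refine le_trans ?_ hbE.le
        rw [hvu b hbA]
        have h1 : (exp (ψ b))^2 ≤ (exp (N/h))^2 := by
          gcongr; exact hψN b
        have h2 : u b * deriv u b ≤ |u b * deriv u b| := le_abs_self _
        have h3 : 0 ≤ G b * (u b)^2 := mul_nonneg (hG0 b) (sq_nonneg _)
        have h4 : B * (G b * (u b)^2) ≤ G b * (u b)^2 := by nlinarith
        calc h^2 * ((exp (ψ b))^2 * (u b * deriv u b)) + B * h^2 * (G b * (exp (ψ b) * u b)^2)
            = h^2 * (exp (ψ b))^2 * (u b * deriv u b + B * (G b * (u b)^2)) := by ring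
          _ ≤ h^2 * (exp (ψ b))^2 * (|u b * deriv u b| + G b * (u b)^2) := by gcongr
          _ ≤ _ := by gcongr
      refine ⟨?_, ?_⟩
      · apply hPN1.congr
        intro x hx
        rw [uIoc_of_le hAb1.le] at hx
        exact hEq x hx
      · rw [← hcong]
        have h1 := mul_le_mul_of_nonneg_left hmono (by linarith : 0 ≤ 1 - B)
        have h2 := mul_le_mul_of_nonneg_left hu2le hκ.le
        linarith
    exact ⟨(hb 1 one_pos).1, le_of_forall_pos_le_add fun η hη => (hb η hη).2⟩
  -- pass to the limit
  set I : ℝ := κ * ∫ x in Ioo A c, (u x)^2 with hI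
  have h1B : 0 < 1 - B := by linarith
  have hPint : IntegrableOn P (Ioc A c) := by
    have hseq : Tendsto (fun n : ℕ => c - (c - A)/2 * (1/((n:ℝ)+1))) atTop (𝓝 c) := by
      have := (tendsto_one_div_add_atTop_nhds_zero_nat (𝕜 := ℝ)).const_mul ((c-A)/2)
      have := this.const_sub c
      simpa using this
    have hin : ∀ n : ℕ, A < c - (c - A)/2 * (1/((n:ℝ)+1)) ∧ c - (c - A)/2 * (1/((n:ℝ)+1)) < c := by
      intro n
      have h0 : 0 < 1/((n:ℝ)+1) := by positivity
      have h1 : 1/((n:ℝ)+1) ≤ 1 := by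
        rw [div_le_one (by positivity)]; linarith [(Nat.cast_nonneg n : (0:ℝ) ≤ n)]
      constructor <;> nlinarith
    apply integrableOn_Ioc_of_intervalIntegral_norm_bounded_right (I := I/(1-B)) _ hseq
    · refine Filter.Eventually.of_forall fun n => ?_
      have := (step _ (hin n).1 (hin n).2).2
      rw [intervalIntegral.integral_of_le (hin n).1.le] at this
      rw [le_div_iff₀ h1B, mul_comm]
      simp_rw [Real.norm_of_nonneg (hP0 _)]
      exact this
    · intro n
      have := (step _ (hin n).1 (hin n).2).1
      rwa [intervalIntegrable_iff_integrableOn_Ioc_of_le (hin n).1.le] at this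
  have hPle : (1-B) * (∫ x in Ioo A c, P x) ≤ I := by
    rw [← integral_Ioc_eq_integral_Ioo, ← intervalIntegral.integral_of_le hAc.le]
    have hii : IntervalIntegrable P volume A c := by
      rwa [intervalIntegrable_iff_integrableOn_Ioc_of_le hAc.le]
    have hcont : ContinuousOn (fun b => ∫ x in A..b, P x) (uIcc A c) :=
      intervalIntegral.continuousOn_primitive_interval' hii left_mem_uIcc
    have hcc := hcont c right_mem_uIcc
    rw [uIcc_of_le hAc.le] at hcc
    have ht : Tendsto (fun b => ∫ x in A..b, P x) (𝓝[<] c) (𝓝 (∫ x in A..c, P x)) := by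
      apply hcc.tendsto.mono_left
      rw [← nhdsWithin_Ioo_eq_nhdsLT hAc]
      exact nhdsWithin_mono _ Ioo_subset_Icc_self
    apply le_of_tendsto (ht.const_mul (1-B))
    filter_upwards [Ioo_mem_nhdsLT hAc] with b hb
    exact (step b hb.1 hb.2).2
  have hPo : IntegrableOn P (Ioo A c) := hPint.mono_set Ioo_subset_Ioc_self
  have hwc : ContinuousOn w (Ioo A c) := by
    apply ContinuousOn.mul
    · apply Real.continuous_exp.comp_continuousOn
      exact ((continuousOn_const.mul (hdcont.mono Ioo_subset_Ico_self)).div_const h)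
    · exact hu2.continuousOn.mono Ioo_subset_Ico_self
  have i1 : IntegrableOn (fun x => h^2 * (deriv w x)^2) (Ioo A c) := by
    refine Integrable.mono' hPo
      (((measurable_deriv w).pow_const 2).const_mul _).aestronglyMeasurable ?_
    refine Filter.Eventually.of_forall fun x => ?_
    rw [Real.norm_of_nonneg (by positivity)]
    have : 0 ≤ Ω.indicator (fun t => (w t)^2) x := indicator_nonneg (fun t _ => sq_nonneg _) x
    simp only [hP]
    have := mul_nonneg (sq_nonneg ε) this
    linarith
  have i2 : IntegrableOn (fun x => ε^2 * Ω.indicator (fun t => (w t)^2) x) (Ioo A c) := by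
    have := hPo.sub i1
    refine this.congr ?_
    refine Filter.Eventually.of_forall fun x => ?_
    simp [hP]
  have hsum : ∫ x in Ioo A c, P x = (∫ x in Ioo A c, h^2 * (deriv w x)^2)
      + ε^2 * ∫ x in Ω, (w x)^2 := by
    have e1 : ∫ x in Ioo A c, P x = (∫ x in Ioo A c, h^2 * (deriv w x)^2)
      + ∫ x in Ioo A c, ε^2 * Ω.indicator (fun t => (w t)^2) x := integral_add i1 i2
    have e2 : ∫ x in Ioo A c, ε^2 * Ω.indicator (fun t => (w t)^2) x
        = ε^2 * ∫ x in Ω, (w x)^2 := by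
      rw [integral_const_mul, ← integral_Ico_eq_integral_Ioo,
        setIntegral_indicator hΩm, inter_eq_self_of_subset_right (fun x hx => hx.1)]
    rw [e1, e2]
  rw [hsum] at hPle
  have hfin : ∀ x, exp (2 * (1-ε) * d x / h) * (u x)^2 = (w x)^2 := by
    intro x
    simp only [hw]
    rw [mul_pow, ← Real.exp_nat_mul]
    congr 2
    push_cast; ring
  simp_rw [hfin]
  exact hPle

lemma amgm_aux (r p q : ℝ) : r * |p * q| ≤ q^2 + r^2 * p^2 := by
  rw [abs_mul, ← sq_abs q, ← sq_abs p]
  nlinarith [sq_nonneg (r * |p| - |q|), sq_nonneg (r * |p|), sq_nonneg (|q|)]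

set_option maxHeartbeats 2000000

/-- the Agmon estimate for eigenfunctions of the Dirichlet problem. -/
theorem statement9 (M l a α : ℝ) (hM : 0 < M) (hl : 0 < l) (ha : |a| < l) (hα : α < 9/4)
    (rp : ℝ) (hrp : 0 < rp) (hrp0 : Dm M l a rp = 0)
    (hrppos : ∀ r, rp < r → 0 < Dm M l a r)
    (rmax : ℝ) (hrmax : rp < rmax)
    (hmax : ∀ r ∈ Set.Ici rp, r ≠ rmax → Vsig M l a r < Vsig M l a rmax)
    (R : ℝ → ℝ) (hRmono : StrictMonoOn R (Set.Iio (π/2)))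
    (hRim : R '' Set.Iio (π/2) = Set.Ioi rp)
    (hRderiv : ∀ x < π/2, HasDerivAt R (Dm M l a (R x) / ((R x)^2 + a^2)) x)
    (hRtop : Filter.Tendsto R (nhdsWithin (π/2) (Set.Iio (π/2))) Filter.atTop)
    (xmax : ℝ) (hxmax : xmax < π/2) (hRxmax : R xmax = rmax)
    :
    ∃ ε₀ ∈ Set.Ioo (0:ℝ) 1, ∃ H₀ > 0, ∃ D > 0,
      ∀ h ∈ Set.Ioc 0 H₀, ∀ κ > 0, ∀ u : ℝ → ℝ,
        (∃ x ∈ Set.Ico xmax (π/2), u x ≠ 0) →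
        ContDiffOn ℝ 2 u (Set.Ico xmax (π/2)) →
        (∀ x ∈ Set.Ioo xmax (π/2),
          -h^2 * deriv (deriv u) x + Vfull M l a α R h x * u x = κ * u x) →
        u xmax = 0 →
        MeasureTheory.IntegrableOn (fun x => (deriv u x)^2 + (R x)^2 * (u x)^2)
          (Set.Ioo xmax (π/2)) →
        {x ∈ Set.Ico xmax (π/2) | Vfull M l a α R h x ≤ κ}.Nonempty →
        ∀ ε ∈ Set.Ioc (0:ℝ) ε₀,
          (∫ x in Set.Ioo xmax (π/2),
              h^2 * (deriv (fun t =>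
                Real.exp ((1 - ε) * agmonDist M l a α R xmax h κ t / h) * u t) x)^2)
            + ε^2 * (∫ x in {x ∈ Set.Ico xmax (π/2) | Vfull M l a α R h x > κ + ε},
                Real.exp (2 * (1 - ε) * agmonDist M l a α R xmax h κ x / h) * (u x)^2)
          ≤ D * (κ + ε)
            * Real.exp (2 * sSup (agmonDist M l a α R xmax h κ ''
                {x ∈ Set.Ico xmax (π/2) | Vfull M l a α R h x ≤ κ + ε}) / h)
            * ∫ x in Set.Ioo xmax (π/2), (u x)^2 := by
  have hlinv : 0 < l^2 := by positivity
  have hrm : 0 < rmax := hrp.trans hrmax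
  obtain ⟨β, hβdef⟩ : ∃ β, β = max (α - 2) 0 := ⟨_, rfl⟩
  have hβ : α - 2 ≤ β := by rw [hβdef]; exact le_max_left _ _
  have hβ0 : 0 ≤ β := by rw [hβdef]; exact le_max_right _ _
  have hβ4 : β < 1/4 := by rw [hβdef]; exact max_lt (by linarith) (by norm_num)
  obtain ⟨r0, hr0⟩ : ∃ r0, r0 = rmax + 1 + 4*M*l^2 := ⟨_, rfl⟩
  have hMl : 0 < 4*M*l^2 := by positivity
  have hr01 : 1 ≤ r0 := by linarith
  have hr04 : 4*M*l^2 ≤ r0 := by linarith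
  obtain ⟨C, hC⟩ : ∃ C, C = 4*M/rmax + |α| * a^2/l^2 + r0^2/l^2 := ⟨_, rfl⟩
  have hC0 : 0 ≤ C := by rw [hC]; positivity
  have hB1 : 4*β < 1 := by linarith
  have hRge : ∀ x ∈ Ico xmax (π/2), rmax ≤ R x := by
    intro x hx
    rw [← hRxmax]
    exact hRmono.monotoneOn hxmax hx.2 hx.1
  have hRpos : ∀ x < π/2, rp < R x := by
    intro x hx
    have : R x ∈ R '' Set.Iio (π/2) := ⟨x, hx, rfl⟩
    rwa [hRim] at this
  have hRcont : ContinuousOn R (Iio (π/2)) := fun x hx =>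
    (hRderiv x hx).continuousAt.continuousWithinAt
  have hsne : ∀ x ∈ Iio (π/2), (R x)^2 + a^2 ≠ 0 := by
    intro x hx
    have : 0 < R x := hrp.trans (hRpos x hx)
    positivity
  have hDmc : ContinuousOn (fun x => Dm M l a (R x)) (Iio (π/2)) := by
    unfold Dm; fun_prop
  have hR'c : ContinuousOn (fun x => Dm M l a (R x) / ((R x)^2 + a^2)) (Iio (π/2)) :=
    hDmc.div (by fun_prop) hsne
  refine ⟨1/2, ⟨by norm_num, by norm_num⟩, 1/(1+C), by positivity, 1/(1-4*β),
    by apply one_div_pos.mpr; linarith, ?_⟩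
  intro h hh κ hκ u _ hu2 hode hu0 hint hne ε hε
  have hh0 : 0 < h := hh.1
  have hhC : h^2 * (4*M/rmax + |α| * a^2/l^2 + r0^2/l^2) ≤ 1 := by
    rw [← hC]
    have h1 : h * (1 + C) ≤ 1 := by
      have := hh.2; rwa [le_div_iff₀ (by positivity)] at this
    have h2 : 0 ≤ h * C := by positivity
    nlinarith
  have hVc : ContinuousOn (Vfull M l a α R h) (Iio (π/2)) := by
    unfold Vfull Vsig Vjunk Vmass
    have hs2 : ∀ n : ℕ, ∀ x ∈ Iio (π/2), ((R x)^2 + a^2)^n ≠ 0 := fun n x hx => pow_ne_zero n (hsne x hx)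
    have hsc : ∀ n : ℕ, ContinuousOn (fun x => ((R x)^2 + a^2)^n) (Iio (π/2)) := fun n => by fun_prop
    have hnum : ContinuousOn (fun x => 5*(R x)^4/l^2 + 3*(R x)^2*(1+a^2/l^2) - 4*M*(R x) + a^2)
      (Iio (π/2)) := by fun_prop
    have j1 := hDmc.div (hsc 2) (hs2 2)
    have j2 := ((continuousOn_const (c := (3:ℝ)).mul (hRcont.pow 2)).mul (hDmc.pow 2)).div (hsc 4) (hs2 4)
    have j3 := (hDmc.mul hnum).div (hsc 3) (hs2 3)
    have j4 := (hDmc.mul (hRcont.pow 2)).div (hsc 2) (hs2 2)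
    exact j1.add (continuousOn_const.mul ((((j2.neg.add j3).sub (continuousOn_const.mul j4)).sub
      (((continuousOn_const.mul j1).mul continuousOn_const).mul continuousOn_const)).add
      (continuousOn_const.mul j4)))
  obtain ⟨G, hG⟩ : ∃ G : ℝ → ℝ, G = fun x => max 0 ((R x - r0)/(2*l^2)) := ⟨_, rfl⟩
  have hG0 : ∀ x, 0 ≤ G x := by intro x; rw [hG]; exact le_max_left _ _
  have Gac : ∀ b, xmax < b → b < π/2 → AbsolutelyContinuousOnInterval G xmax b := by
    intro b hb1 hb2
    have hsub : Icc xmax b ⊆ Iio (π/2) := fun t ht => lt_of_le_of_lt ht.2 hb2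
    obtain ⟨K, hK⟩ := isCompact_Icc.exists_bound_of_continuousOn (hR'c.mono hsub)
    have hRlip : LipschitzOnWith K.toNNReal R (Icc xmax b) := by
      apply (convex_Icc xmax b).lipschitzOnWith_of_nnnorm_hasDerivWithin_le
        (fun x hx => (hRderiv x (hsub hx)).hasDerivWithinAt)
      intro x hx
      rw [← NNReal.coe_le_coe, coe_nnnorm]
      exact (hK x hx).trans (Real.le_coe_toNNReal K)
    apply LipschitzOnWith.absolutelyContinuousOnInterval (K := (1/(2*l^2)).toNNReal * K.toNNReal)
    rw [uIcc_of_le hb1.le]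
    apply LipschitzOnWith.of_dist_le_mul
    intro x hx y hy
    have h0 : 0 ≤ 1/(2*l^2) := by positivity
    rw [NNReal.coe_mul, Real.coe_toNNReal _ h0, mul_assoc]
    refine le_trans ?_ (mul_le_mul_of_nonneg_left (hRlip.dist_le_mul x hx y hy) h0)
    rw [Real.dist_eq, Real.dist_eq, hG]
    have h1 := abs_max_sub_max_le_max 0 ((R x - r0)/(2*l^2)) 0 ((R y - r0)/(2*l^2))
    have h2 := max_eq_right (abs_nonneg ((R x - r0)/(2*l^2) - (R y - r0)/(2*l^2)))
    rw [sub_self, abs_zero, h2] at h1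
    refine h1.trans (le_of_eq ?_)
    rw [← abs_of_nonneg h0, ← abs_mul]
    congr 1; ring
  have hq : ∀ x ∈ Ioo xmax (π/2), ∀ g', HasDerivAt G g' x →
      0 ≤ g' - (G x)^2 ∧ -(4*β * h^2 * (g' - (G x)^2)) ≤ Vfull M l a α R h x := by
    intro x hx g' hg'
    have hRx := hRge x ⟨hx.1.le, hx.2⟩
    have hDx : 0 ≤ Dm M l a (R x) := (hrppos _ (hRpos x hx.2)).le
    rcases le_or_gt (R x) r0 with hle | hlt
    · have hGx : G x = 0 := by
        rw [hG]; apply max_eq_left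
        apply div_nonpos_of_nonpos_of_nonneg <;> [linarith; positivity]
      have hmin : IsLocalMin G x := by
        refine Filter.Eventually.of_forall fun y => ?_
        rw [hGx]; exact hG0 y
      have hg0 := hmin.hasDerivAt_eq_zero hg'
      have hv := V_low M l a α β (R x) rmax r0 h hM hl hrm hRx hβ hβ0 (by linarith) hDx hle hhC
      rw [hg0, hGx]
      refine ⟨by norm_num, ?_⟩
      unfold Vfull
      simpa using hv
    · have hRcx : ContinuousAt R x := (hRderiv x hx.2).continuousAt
      have hev : G =ᶠ[𝓝 x] fun y => (R y - r0)/(2*l^2) := by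
        filter_upwards [hRcx.eventually (lt_mem_nhds hlt)] with y hy
        rw [hG]; apply max_eq_right
        apply div_nonneg <;> [linarith; positivity]
      have hg1 : g' = Dm M l a (R x) / ((R x)^2 + a^2) / (2*l^2) := by
        apply hg'.unique
        exact (((hRderiv x hx.2).sub_const r0).div_const (2*l^2)).congr_of_eventuallyEq hev
      have hGx : G x = (R x - r0)/(2*l^2) := hev.eq_of_nhds
      rw [hg1, hGx]
      exact V_high M l a α β (R x) rmax r0 h hM hl hrm hRx hβ hβ0 hr01 hr04 hDx hlt.le hhC
  have huint : IntegrableOn (fun x => (u x)^2) (Ioo xmax (π/2)) := by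
    refine Integrable.mono' (hint.const_mul (1/rmax^2)) ?_ ?_
    · exact ((hu2.continuousOn.mono Ioo_subset_Ico_self).pow 2).aestronglyMeasurable measurableSet_Ioo
    · rw [ae_restrict_iff' measurableSet_Ioo]
      refine Filter.Eventually.of_forall fun x hx => ?_
      rw [Real.norm_of_nonneg (sq_nonneg _), one_div, inv_mul_eq_div, le_div_iff₀ (by positivity)]
      have h1 : rmax^2 ≤ (R x)^2 := by
        have := hRge x ⟨hx.1.le, hx.2⟩
        gcongr
      nlinarith [sq_nonneg (deriv u x), mul_le_mul_of_nonneg_right h1 (sq_nonneg (u x))]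
  have hbd : ∀ K > 0, ∀ η > 0, ∃ᶠ b in 𝓝[<] (π/2),
      K * (|u b * deriv u b| + G b * (u b)^2) < η := by
    intro K hK η hη hcon
    have hnot : ¬ IntegrableOn (fun x => (deriv u x)^2 + (R x)^2 * (u x)^2) (Ioo xmax (π/2)) := by
      apply not_integrableOn_of_tendsto_norm_atTop_of_deriv_isBigO_filter
        (f := fun x => Real.log (R x)) (𝓝[<] (π/2)) (Ioo_mem_nhdsLT hxmax)
      · filter_upwards [self_mem_nhdsWithin] with x hx
        exact ((hRderiv x hx).log (hrp.trans (hRpos x hx)).ne').differentiableAt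
      · exact tendsto_norm_atTop_atTop.comp (Real.tendsto_log_atTop.comp hRtop)
      · apply Asymptotics.IsBigO.of_bound ((1/rmax^2 + 1/l^2) * (K * (1 + 1/(2*l^2)) / η))
        filter_upwards [hcon, Ioo_mem_nhdsLT hxmax] with x hx hxI
        rw [not_lt] at hx
        have hRx := hRge x ⟨hxI.1.le, hxI.2⟩
        have hR0 : 0 < R x := hrm.trans_le hRx
        have hDx : 0 ≤ Dm M l a (R x) := (hrppos _ (hRpos x hxI.2)).le
        rw [((hRderiv x hxI.2).log hR0.ne').deriv]
        set Y := (deriv u x)^2 + (R x)^2 * (u x)^2 with hY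
        have hY0 : 0 ≤ Y := by positivity
        rw [Real.norm_of_nonneg (by positivity), Real.norm_of_nonneg hY0]
        have h1 : Dm M l a (R x) / ((R x)^2 + a^2) / R x ≤ (1/rmax^2 + 1/l^2) * R x := by
          rw [div_le_iff₀ hR0, div_le_iff₀ (by positivity)]
          have h2 : 1 ≤ (R x)^2 / rmax^2 := by
            rw [one_le_div (by positivity)]; gcongr
          have h3 : 1 + (R x)^2/l^2 ≤ (1/rmax^2 + 1/l^2) * R x * R x := by
            have : (1/rmax^2 + 1/l^2) * R x * R x = (R x)^2 / rmax^2 + (R x)^2/l^2 := by ring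
            rw [this]; linarith
          unfold Dm
          have h4 := mul_le_mul_of_nonneg_right h3 (by positivity : 0 ≤ (R x)^2 + a^2)
          have h5 : 0 ≤ 2*M*R x := by positivity
          linarith
        have h2 : R x ≤ K * (1 + 1/(2*l^2)) / η * Y := by
          rw [div_mul_eq_mul_div, le_div_iff₀ hη]
          have hGR : G x ≤ 1/(2*l^2) * R x := by
            rw [hG]
            apply max_le (by positivity)
            rw [div_mul_eq_mul_div, one_mul]
            gcongr
            linarith
          have h3 : R x * |u x * deriv u x| ≤ Y := by
            exact amgm_aux _ _ _
          have h4 : R x * (G x * (u x)^2) ≤ 1/(2*l^2) * Y := by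
            calc R x * (G x * (u x)^2) ≤ R x * (1/(2*l^2) * R x * (u x)^2) := by gcongr
              _ = 1/(2*l^2) * ((R x)^2 * (u x)^2) := by ring
              _ ≤ 1/(2*l^2) * Y := by
                gcongr; rw [hY]; linarith [sq_nonneg (deriv u x)]
          calc R x * η ≤ R x * (K * (|u x * deriv u x| + G x * (u x)^2)) := by gcongr
            _ = K * (R x * |u x * deriv u x| + R x * (G x * (u x)^2)) := by ring
            _ ≤ K * (Y + 1/(2*l^2) * Y) := by gcongr
            _ = K * (1 + 1/(2*l^2)) * Y := by ring
        calc _ ≤ (1/rmax^2 + 1/l^2) * R x := h1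
          _ ≤ (1/rmax^2 + 1/l^2) * (K * (1 + 1/(2*l^2)) / η * Y) := by gcongr
          _ = _ := by ring
    exact hnot hint
  have hWc : ContinuousOn (fun t => √(max 0 (Vfull M l a α R h t - κ))) (Iio (π/2)) := by
    apply ContinuousOn.sqrt
    exact continuousOn_const.sup (hVc.sub continuousOn_const)
  have hd0 : ∀ x, 0 ≤ agmonDist M l a α R xmax h κ x := by
    intro x
    apply Real.sInf_nonneg
    rintro _ ⟨y, _, rfl⟩
    exact abs_nonneg _
  have hdS : ∀ x ∈ Ico xmax (π/2), Vfull M l a α R h x ≤ κ →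
      agmonDist M l a α R xmax h κ x = 0 := by
    intro x hx hxk
    apply le_antisymm _ (hd0 x)
    apply csInf_le
    · exact ⟨0, by rintro _ ⟨z, _, rfl⟩; exact abs_nonneg _⟩
    · exact ⟨x, ⟨hx, hxk⟩, by simp⟩
  have hfinal := main_abs (B := 4*β) hxmax hh0 (by linarith) hB1 hκ hε.1
    (by linarith [hε.2]) hVc hu2 hode hu0 Gac hG0 hq hd0 hdS
    (fun x hx y hy => agm_lip hWc (fun z hz => hz.1.2) hne hx hy) huint hbd
  have h1B : 0 < 1 - 4*β := by linarith
  have hI0 : 0 ≤ ∫ x in Ioo xmax (π/2), (u x)^2 := integral_nonneg fun x => sq_nonneg _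
  have hsup : 0 ≤ sSup (agmonDist M l a α R xmax h κ ''
                {x ∈ Set.Ico xmax (π/2) | Vfull M l a α R h x ≤ κ + ε}) := by
    apply Real.sSup_nonneg
    rintro _ ⟨y, _, rfl⟩
    exact hd0 y
  have hexp : 1 ≤ Real.exp (2 * sSup (agmonDist M l a α R xmax h κ ''
                {x ∈ Set.Ico xmax (π/2) | Vfull M l a α R h x ≤ κ + ε}) / h) := by
    apply Real.one_le_exp
    positivity
  generalize Real.exp (2 * sSup (agmonDist M l a α R xmax h κ ''
                {x ∈ Set.Ico xmax (π/2) | Vfull M l a α R h x ≤ κ + ε}) / h) = X at *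
  generalize (∫ x in Ioo xmax (π/2), (u x)^2) = I at *
  rw [mul_comm, ← le_div_iff₀ h1B] at hfinal
  refine hfinal.trans ?_
  have e : 1/(1-4*β) * (κ + ε) * X * I = ((κ+ε) * X * I) / (1 - 4*β) := by ring
  rw [e]
  gcongr
  have hε0 := hε.1
  calc κ ≤ κ + ε := by linarith
    _ ≤ (κ + ε) * X := le_mul_of_one_le_right (by linarith) hexp
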